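/- arXiv:2402.02952 — 2 statements merged into one kernel-verified Lean document; each statement's English description precedes it below -/
import Mathlib

section
/- (Bracketing entropy bound.) Suppose the expert function h is uniformly bounded by M and L₁-Lipschitz in its parameter η uniformly in x. Then there exists a constant C > 0 such that for every 0 < ε ≤ 1/2 there exist an integer N with log N ≤ C·log(1/ε) and pairs of functions (L_1,U_1),…,(L_N,U_N) on 𝒳 with ‖U_i − L_i‖_{L²(μ)} ≤ ε for all i ≤ N, such that every f_G with G ∈ 𝒢_k(Θ) satisfies L_i(x) ≤ f_G(x) ≤ U_i(x) for all x ∈ 𝒳 for some i ≤ N. In other words, the ε-bracketing entropy of the class F_k(Θ) = {f_G : G ∈ 𝒢_k(Θ)} under the L²(μ) norm is at most a constant multiple of log(1/ε). -/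
open MeasureTheory Finset ProbabilityTheory
open scoped BigOperators NNReal ENNReal

noncomputable section

abbrev Vec (n : ℕ) : Type := EuclideanSpace ℝ (Fin n)

/-- A mixing measure `G = ∑ᵢ exp(β₀ᵢ) δ_{(β₁ᵢ, ηᵢ)}` with at most `k` atoms. -/
structure MixM (d q k : ℕ) : Type where
  m : ℕ
  one_le_m : 1 ≤ m
  m_le_k : m ≤ k
  β0 : Fin m → ℝ
  β1 : Fin m → Vec d
  η : Fin m → Vec q

namespace MixM

variable {d q k : ℕ}

/-- Membership `G ∈ 𝒢_k(Θ)`: all parameters lie in `Θ`. -/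
def memΘ (G : MixM d q k) (Θ : Set (ℝ × Vec d × Vec q)) : Prop :=
  ∀ i, (G.β0 i, G.β1 i, G.η i) ∈ Θ

/-- The softmax-gating mixture-of-experts regression function `f_G`. -/
def moe (h : Vec d → Vec q → ℝ) (G : MixM d q k) (x : Vec d) : ℝ :=
  (∑ i, Real.exp ((∑ u, G.β1 i u * x u) + G.β0 i) * h x (G.η i)) /
    ∑ j, Real.exp ((∑ u, G.β1 j u * x u) + G.β0 j)

/-- The last atom index, used for the normalization `β*_{0 k_*} = 0`, `β*_{1 k_*} = 0`. -/
def lastIdx (G : MixM d q k) : Fin G.m := ⟨G.m - 1, Nat.sub_lt G.one_le_m Nat.one_pos⟩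

open scoped Classical in
/-- Voronoi cell `𝒜_j(G)` generated by the `j`-th atom of `Gs`. -/
def cell (G Gs : MixM d q k) (j : Fin Gs.m) : Finset (Fin G.m) :=
  Finset.univ.filter fun i =>
    ∀ l, l ≠ j →
      ‖G.β1 i - Gs.β1 j‖ ^ 2 + ‖G.η i - Gs.η j‖ ^ 2 ≤
        ‖G.β1 i - Gs.β1 l‖ ^ 2 + ‖G.η i - Gs.η l‖ ^ 2

open scoped Classical in
/-- The Voronoi loss `D₁(G, Gs)`. -/
def D1 (G Gs : MixM d q k) : ℝ :=
  (∑ j, |(∑ i ∈ cell G Gs j, Real.exp (G.β0 i)) - Real.exp (Gs.β0 j)|) +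
    (∑ j ∈ Finset.univ.filter (fun j => 1 < (cell G Gs j).card),
      ∑ i ∈ cell G Gs j,
        Real.exp (G.β0 i) * (‖G.β1 i - Gs.β1 j‖ ^ 2 + ‖G.η i - Gs.η j‖ ^ 2)) +
    ∑ j ∈ Finset.univ.filter (fun j => (cell G Gs j).card = 1),
      ∑ i ∈ cell G Gs j,
        Real.exp (G.β0 i) * (‖G.β1 i - Gs.β1 j‖ + ‖G.η i - Gs.η j‖)

open scoped Classical in
/-- Equality of mixing measures (as discrete measures on the atom space). -/
def measEq (G H : MixM d q k) : Prop :=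
  ∀ s : Set (Vec d × Vec q),
    (∑ i, if (G.β1 i, G.η i) ∈ s then Real.exp (G.β0 i) else 0) =
      ∑ i, if (H.β1 i, H.η i) ∈ s then Real.exp (H.β0 i) else 0

end MixM

/-- The `L²(μ)` distance between two functions. -/
def l2 {X : Type*} [MeasurableSpace X] (μ : Measure X) (f g : X → ℝ) : ℝ :=
  Real.sqrt (∫ x, (f x - g x) ^ 2 ∂μ)

/-- Monomial `x^ν`. -/
def mono {d : ℕ} (ν : Fin d → ℕ) (x : Vec d) : ℝ := ∏ u, x u ^ ν u

/-- Total degree `|ν|`of a multi-index. -/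
def deg {d : ℕ} (ν : Fin d → ℕ) : ℕ := ∑ u, ν u

/-- Finite set of multi-indices with all entries `≤ 2` (contains all `ν` with `|ν| ≤ 2`). -/
def mIdx (d : ℕ) : Finset (Fin d → ℕ) :=
  Finset.image (fun (f : Fin d → Fin 3) u => (f u : ℕ)) Finset.univ

/-- Partial derivative operator in direction `u`. -/
def pdOp {q : ℕ} (u : Fin q) (g : Vec q → ℝ) : Vec q → ℝ :=
  fun η => fderiv ℝ g η (EuclideanSpace.single u 1)

/-- Iterated partial derivative `∂^{|τ|}/∂η^τ` along a multi-index `τ`. -/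
def mpd {q : ℕ} (τ : Fin q → ℕ) (f : Vec q → ℝ) : Vec q → ℝ :=
  (List.finRange q).foldr (fun u g => (pdOp u)^[τ u] g) f

/-- Strong identifiability of an expert function (Definition 3.1). -/
def StronglyIdentifiable {d q : ℕ} (μ : Measure (Vec d)) (h : Vec d → Vec q → ℝ) : Prop :=
  (∀ x, ContDiff ℝ 2 (h x)) ∧
    ∀ m : ℕ, 1 ≤ m → ∀ η : Fin m → Vec q, Function.Injective η →
      ∀ c : Fin m → (Fin d → ℕ) → (Fin q → ℕ) → ℝ,
        (∀ j ν τ, 2 < deg ν + deg τ → c j ν τ = 0) →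
        (∀ᵐ x ∂μ,
          (∑ j, ∑ ν ∈ mIdx d, ∑ τ ∈ mIdx q, c j ν τ * mono ν x * mpd τ (h x) (η j)) = 0) →
        ∀ j ν τ, c j ν τ = 0


lemma moe_abs_le {d q k : ℕ} (h : Vec d → Vec q → ℝ) (M : ℝ) (hM : ∀ x η', |h x η'| ≤ M)
    (G : MixM d q k) (x : Vec d) : |MixM.moe h G x| ≤ M := by
  have hne : Nonempty (Fin G.m) := ⟨⟨0, G.one_le_m⟩⟩
  have hW : 0 < ∑ j, Real.exp ((∑ u, G.β1 j u * x u) + G.β0 j) :=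
    Finset.sum_pos (fun i _ => Real.exp_pos _) Finset.univ_nonempty
  unfold MixM.moe
  rw [abs_div, abs_of_pos hW, div_le_iff₀ hW, Finset.mul_sum]
  refine (Finset.abs_sum_le_sum_abs _ _).trans (Finset.sum_le_sum fun i _ => ?_)
  rw [abs_mul, abs_of_pos (Real.exp_pos _), mul_comm]
  exact mul_le_mul_of_nonneg_right (hM _ _) (Real.exp_pos _).le

/-- Abstract stability of the softmax average. -/
lemma softmax_stab {m : ℕ} (hm : 1 ≤ m) (a a' b b' : Fin m → ℝ) (M s t F' : ℝ)
    (hs1 : s ≤ 1) (ha : ∀ i, |a i - a' i| ≤ s) (hb : ∀ i, |b i - b' i| ≤ t)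
    (hb' : ∀ i, |b' i| ≤ M) (hF'M : |F'| ≤ M)
    (hF' : F' = (∑ i, Real.exp (a' i) * b' i) / ∑ j, Real.exp (a' j)) :
    |(∑ i, Real.exp (a i) * b i) / (∑ j, Real.exp (a j)) - F'| ≤ t + 4 * M * s := by
  have hne : Nonempty (Fin m) := ⟨⟨0, hm⟩⟩
  have hW : 0 < ∑ j, Real.exp (a j) :=
    Finset.sum_pos (fun i _ => Real.exp_pos _) Finset.univ_nonempty
  have hW' : 0 < ∑ j, Real.exp (a' j) :=
    Finset.sum_pos (fun i _ => Real.exp_pos _) Finset.univ_nonempty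
  have hM0 : 0 ≤ M := (abs_nonneg _).trans hF'M
  have h0 : ∑ i, Real.exp (a' i) * (b' i - F') = 0 := by
    simp only [mul_sub, Finset.sum_sub_distrib, ← Finset.sum_mul]
    rw [hF']; field_simp; ring
  have key : (∑ i, Real.exp (a i) * b i) / (∑ j, Real.exp (a j)) - F' =
      (∑ i, (Real.exp (a i) * (b i - b' i) + (Real.exp (a i) - Real.exp (a' i)) * (b' i - F'))) /
        (∑ j, Real.exp (a j)) := by
    have : ∑ i, (Real.exp (a i) * (b i - b' i) +
        (Real.exp (a i) - Real.exp (a' i)) * (b' i - F')) =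
        ∑ i, Real.exp (a i) * b i - F' * ∑ i, Real.exp (a i) := by
      rw [Finset.mul_sum, ← Finset.sum_sub_distrib, ← sub_zero (∑ i, (_ - _)), ← h0,
        ← sub_eq_zero, ← Finset.sum_sub_distrib, ← Finset.sum_sub_distrib]
      refine Finset.sum_eq_zero fun i _ => ?_
      ring_nf
      try linarith
    rw [this]; field_simp
  rw [key, abs_div, abs_of_pos hW, div_le_iff₀ hW, Finset.mul_sum]
  refine (Finset.abs_sum_le_sum_abs _ _).trans (Finset.sum_le_sum fun i _ => ?_)
  have hw := Real.exp_pos (a i)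
  have e1 : |Real.exp (a i) - Real.exp (a' i)| ≤ Real.exp (a i) * (2 * s) := by
    have : Real.exp (a' i) = Real.exp (a i) * Real.exp (a' i - a i) := by
      rw [← Real.exp_add]; congr 1; ring
    have h2 : Real.exp (a i) - Real.exp (a' i) =
      -(Real.exp (a i) * (Real.exp (a' i - a i) - 1)) := by rw [this]; ring
    have h3 : |a' i - a i| ≤ s := by rw [abs_sub_comm]; exact ha i
    rw [h2, abs_neg, abs_mul, abs_of_pos hw]
    refine mul_le_mul_of_nonneg_left ?_ hw.le
    exact (Real.abs_exp_sub_one_le (h3.trans hs1)).trans (by linarith)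
  have e2 : |b' i - F'| ≤ 2 * M := (abs_sub _ _).trans (by linarith [hb' i])
  calc _ ≤ |Real.exp (a i) * (b i - b' i)| +
        |(Real.exp (a i) - Real.exp (a' i)) * (b' i - F')| := abs_add_le _ _
    _ ≤ Real.exp (a i) * t + (Real.exp (a i) * (2 * s)) * (2 * M) := by
        rw [abs_mul, abs_mul, abs_of_pos hw]
        have := hb i
        have hs0 : 0 ≤ s := (abs_nonneg _).trans (ha i)
        gcongr
    _ = _ := by ring

lemma vec_norm_le {q : ℕ} (v : Vec q) (δ : ℝ) (hv : ∀ u, |v u| ≤ δ) : ‖v‖ ≤ q * δ := by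
  have : v = ∑ u, EuclideanSpace.single u (v u) := by
    ext i
    simp [Finset.sum_apply, Pi.single_apply]
  rw [this]
  refine (norm_sum_le _ _).trans ?_
  calc _ ≤ ∑ u : Fin q, δ := Finset.sum_le_sum fun u _ => by simpa using hv u
    _ = _ := by simp

/-- Padded coordinates of a mixing measure. -/
def parC {d q k : ℕ} (G : MixM d q k) (p : Fin k × (Unit ⊕ Fin d ⊕ Fin q)) : ℝ :=
  if hi : (p.1 : ℕ) < G.m then
    Sum.elim (fun _ => G.β0 ⟨p.1, hi⟩) (Sum.elim (fun u => G.β1 ⟨p.1, hi⟩ u)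
      (fun u => G.η ⟨p.1, hi⟩ u)) p.2
  else 0

lemma moe_close {d q k : ℕ} (h : Vec d → Vec q → ℝ) (M L₁ B δ : ℝ) (hM : ∀ x η', |h x η'| ≤ M)
    (hLip : ∀ x η₁ η₂, |h x η₁ - h x η₂| ≤ L₁ * ‖η₁ - η₂‖)
    (hδB : δ * (d * B + 1) ≤ 1) (x : Vec d) (hx : ∀ u, |x u| ≤ B)
    (G G' : MixM d q k) (hm : G.m = G'.m) (hδ : 0 ≤ δ)
    (hp : ∀ p, |parC G p - parC G' p| ≤ δ) :
    |MixM.moe h G x - MixM.moe h G' x| ≤ δ * (|L₁| * q + 4 * M * (d * B + 1)) := by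
  have hF := moe_abs_le h M hM G' x
  obtain ⟨m, h1, h2, b0, b1, e⟩ := G
  obtain ⟨m', h1', h2', b0', b1', e'⟩ := G'
  obtain rfl : m = m' := hm
  have p0 : ∀ i, |b0 i - b0' i| ≤ δ := fun i => by
    simpa [parC] using hp (⟨i, i.2.trans_le h2⟩, Sum.inl ())
  have p1 : ∀ i u, |b1 i u - b1' i u| ≤ δ := fun i u => by
    simpa [parC] using hp (⟨i, i.2.trans_le h2⟩, Sum.inr (Sum.inl u))
  have p2 : ∀ i u, |e i u - e' i u| ≤ δ := fun i u => by
    simpa [parC] using hp (⟨i, i.2.trans_le h2⟩, Sum.inr (Sum.inr u))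
  have := softmax_stab h1 (fun i => (∑ u, b1 i u * x u) + b0 i)
    (fun i => (∑ u, b1' i u * x u) + b0' i) (fun i => h x (e i)) (fun i => h x (e' i))
    M (δ * (d * B + 1)) (|L₁| * (q * δ)) _ hδB ?_ ?_ (fun i => hM _ _) hF rfl
  · refine this.trans (le_of_eq (by ring))
  · intro i
    have e1 : ((∑ u, b1 i u * x u) + b0 i) - ((∑ u, b1' i u * x u) + b0' i) =
      (∑ u, (b1 i u - b1' i u) * x u) + (b0 i - b0' i) := by
      simp only [sub_mul, Finset.sum_sub_distrib]; ring
    have e2 : |∑ u, (b1 i u - b1' i u) * x u| ≤ ∑ u : Fin d, δ * B := by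
      refine (Finset.abs_sum_le_sum_abs _ _).trans (Finset.sum_le_sum fun u _ => ?_)
      rw [abs_mul]
      exact mul_le_mul (p1 i u) (hx u) (abs_nonneg _) hδ
    simp only [Finset.sum_const, Finset.card_univ, Fintype.card_fin, nsmul_eq_mul] at e2
    show |_ - _| ≤ _
    rw [e1]
    refine (abs_add_le _ _).trans ?_
    have := p0 i
    linarith
  · intro i
    refine (hLip _ _ _).trans ?_
    have := vec_norm_le (e i - e' i) δ (fun u => by simpa using p2 i u)
    exact mul_le_mul (le_abs_self _) this (norm_nonneg _) (abs_nonneg _)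

lemma floor_close (δ R t t' : ℝ) (hδ : 0 < δ) (ht : |t| ≤ R) (ht' : |t'| ≤ R)
    (hf : ⌊(t + R) / δ⌋₊ = ⌊(t' + R) / δ⌋₊) : |t - t'| ≤ δ := by
  rw [abs_le] at ht ht'
  have a1 := Nat.floor_le (a := (t + R) / δ) (div_nonneg (by linarith) hδ.le)
  have a2 := Nat.floor_le (a := (t' + R) / δ) (div_nonneg (by linarith) hδ.le)
  have b1 := Nat.lt_floor_add_one ((t + R) / δ)
  have b2 := Nat.lt_floor_add_one ((t' + R) / δ)
  rw [hf] at a1 b1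
  have c1 : (t + R) / δ - (t' + R) / δ ≤ 1 := by linarith
  have c2 : (t' + R) / δ - (t + R) / δ ≤ 1 := by linarith
  rw [← sub_div, div_le_one hδ] at c1 c2
  rw [abs_le]; constructor <;> linarith

/-- Bracketing entropy bound: the class `{f_G : G ∈ 𝒢_k(Θ)}` has `ε`-bracketing entropy
of order `log(1/ε)` under the `L²(μ)` norm. -/
theorem bracketing_entropy_bound
    {d q k : ℕ}
    (Θ : Set (ℝ × Vec d × Vec q)) (hΘcpt : IsCompact Θ)
    (𝓧 : Set (Vec d)) (h𝓧bdd : Bornology.IsBounded 𝓧)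
    (μ : Measure (Vec d)) [IsProbabilityMeasure μ] (hμ𝓧 : μ 𝓧ᶜ = 0)
    (h : Vec d → Vec q → ℝ)
    (M L₁ : ℝ) (hM : ∀ x η', |h x η'| ≤ M)
    (hLip : ∀ x η₁ η₂, |h x η₁ - h x η₂| ≤ L₁ * ‖η₁ - η₂‖) :
    ∃ C > 0, ∀ ε : ℝ, 0 < ε → ε ≤ 1 / 2 →
      ∃ (N : ℕ) (L U : Fin N → Vec d → ℝ),
        1 ≤ N ∧ Real.log N ≤ C * Real.log (1 / ε) ∧
        (∀ i, l2 μ (U i) (L i) ≤ ε) ∧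
        ∀ G : MixM d q k, G.memΘ Θ →
          ∃ i, ∀ x ∈ 𝓧, L i x ≤ MixM.moe h G x ∧ MixM.moe h G x ≤ U i x := by
  classical
  obtain ⟨B, hB0, hB⟩ : ∃ B : ℝ, 0 ≤ B ∧ ∀ x ∈ 𝓧, ∀ u, |x u| ≤ B := by
    obtain ⟨B, hB⟩ := h𝓧bdd.exists_norm_le
    refine ⟨max B 0, le_max_right _ _, fun x hx u => ?_⟩
    have := PiLp.norm_apply_le x u
    exact (this.trans (hB x hx)).trans (le_max_left _ _)
  obtain ⟨R, hR0, hR⟩ : ∃ R : ℝ, 0 ≤ R ∧ ∀ θ ∈ Θ, ‖θ‖ ≤ R := by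
    obtain ⟨R, hR⟩ := hΘcpt.isBounded.exists_norm_le
    exact ⟨max R 0, le_max_right _ _, fun x hx => (hR x hx).trans (le_max_left _ _)⟩
  have hM0 : 0 ≤ M := (abs_nonneg _).trans (hM 0 0)
  have hpar : ∀ G : MixM d q k, G.memΘ Θ → ∀ p, |parC G p| ≤ R := by
    intro G hG p
    unfold parC
    split_ifs with hi
    · have hn := hR _ (hG ⟨p.1, hi⟩)
      have h1 := (norm_fst_le _).trans hn
      have h2 := (norm_snd_le _).trans hn
      have h3 := (norm_fst_le _).trans h2
      have h4 := (norm_snd_le _).trans h2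
      rcases p.2 with _ | u | u
      · exact h1
      · exact (PiLp.norm_apply_le (G.β1 ⟨p.1, hi⟩) u).trans h3
      · exact (PiLp.norm_apply_le (G.η ⟨p.1, hi⟩) u).trans h4
    · simpa using hR0
  set E : ℝ := d * B + 1 with hE
  have hE1 : 1 ≤ E := by
    have : 0 ≤ (d : ℝ) * B := by positivity
    linarith
  set D : ℝ := |L₁| * q + 4 * M * E + E with hD
  have hX0 : 0 ≤ |L₁| * q + 4 * M * E := by positivity
  have hDE : E ≤ D := by linarith
  have hD1 : 1 ≤ D := by linarith
  set A : ℝ := 4 * R * D + 1 with hA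
  have hA1 : 1 ≤ A := by
    have : 0 ≤ 4 * R * D := by positivity
    linarith
  set n : ℕ := Fintype.card (Fin k × (Unit ⊕ Fin d ⊕ Fin q)) with hn
  have hl2 : 0 < Real.log 2 := Real.log_pos (by norm_num)
  have hlA : 0 ≤ Real.log A := Real.log_nonneg hA1
  have hlk : 0 ≤ Real.log ((k : ℝ) + 1) := Real.log_nonneg (by linarith [k.cast_nonneg (α := ℝ)])
  refine ⟨(Real.log ((k : ℝ) + 1) + n * Real.log A) / Real.log 2 + n + 1, by positivity, ?_⟩
  intro ε hε hε2
  set δ : ℝ := ε / (2 * D) with hδ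
  have hδ0 : 0 < δ := by positivity
  have hδD : δ * D = ε / 2 := by rw [hδ]; field_simp
  set K : ℕ := ⌊2 * R / δ⌋₊ with hK
  let T := Fin (k + 1) × (Fin k × (Unit ⊕ Fin d ⊕ Fin q) → Fin (K + 1))
  let code : MixM d q k → T := fun G =>
    (Fin.ofNat (k + 1) G.m, fun p => Fin.ofNat (K + 1) ⌊(parC G p + R) / δ⌋₊)
  have hcode : ∀ G G' : MixM d q k, G.memΘ Θ → G'.memΘ Θ → code G = code G' →
      ∀ x ∈ 𝓧, |MixM.moe h G x - MixM.moe h G' x| ≤ ε / 2 := by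
    intro G G' hG hG' hc x hx
    have hc1 : G.m = G'.m := by
      have := congrArg (fun t : T => (t.1 : ℕ)) hc
      simpa [code, Nat.mod_eq_of_lt (Nat.lt_succ_of_le G.m_le_k),
        Nat.mod_eq_of_lt (Nat.lt_succ_of_le G'.m_le_k)] using this
    have hlt : ∀ t : ℝ, |t| ≤ R → ⌊(t + R) / δ⌋₊ < K + 1 := fun t ht => by
      refine Nat.lt_succ_of_le (Nat.floor_le_floor ?_)
      have := (abs_le.1 ht).2
      gcongr
      linarith
    have hc2 : ∀ p, |parC G p - parC G' p| ≤ δ := by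
      intro p
      refine floor_close δ R _ _ hδ0 (hpar G hG p) (hpar G' hG' p) ?_
      have := congrArg (fun t : T => (t.2 p : ℕ)) hc
      simpa [code, Nat.mod_eq_of_lt (hlt _ (hpar G hG p)),
        Nat.mod_eq_of_lt (hlt _ (hpar G' hG' p))] using this
    have hδE : δ * E ≤ 1 := by
      have : δ * E ≤ δ * D := by gcongr
      linarith
    refine (moe_close h M L₁ B δ hM hLip hδE x (hB x hx) G G' hc1 hδ0.le hc2).trans ?_
    rw [← hδD]
    gcongr
    linarith
  let rep : T → Vec d → ℝ := fun t =>
    if ht : ∃ G : MixM d q k, G.memΘ Θ ∧ code G = t then MixM.moe h ht.choose else 0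
  let eqv := Fintype.equivFin T
  refine ⟨Fintype.card T, fun i x => rep (eqv.symm i) x - ε / 2,
    fun i x => rep (eqv.symm i) x + ε / 2, ?_, ?_, ?_, ?_⟩
  · exact Fintype.card_pos
  · have hcard : (Fintype.card T : ℝ) = ((k : ℝ) + 1) * ((K : ℝ) + 1) ^ n := by
      simp only [T, Fintype.card_prod (Fin (k+1)), Fintype.card_fun, Fintype.card_fin, ← hn]
      push_cast; rfl
    have hKle : (K : ℝ) + 1 ≤ A / ε := by
      have h1 : (K : ℝ) ≤ 2 * R / δ := Nat.floor_le (by positivity)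
      have h2 : 2 * R / δ = 4 * R * D / ε := by rw [hδ]; field_simp; ring
      have h3 : 1 ≤ 1 / ε := by rw [le_div_iff₀ hε]; linarith
      rw [hA, add_div]
      linarith
    have hlK : Real.log ((K : ℝ) + 1) ≤ Real.log A + Real.log (1 / ε) := by
      rw [← Real.log_mul (by positivity) (by positivity), mul_one_div]
      exact Real.log_le_log (by positivity) hKle
    have hle : Real.log 2 ≤ Real.log (1 / ε) := by
      refine Real.log_le_log (by norm_num) ?_
      rw [le_div_iff₀ hε]; linarith
    rw [hcard, Real.log_mul (by positivity) (by positivity), Real.log_pow]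
    have s1 : (n : ℝ) * Real.log ((K : ℝ) + 1) ≤ n * (Real.log A + Real.log (1 / ε)) := by gcongr
    have s2 : Real.log ((k : ℝ) + 1) + n * Real.log A ≤
        (Real.log ((k : ℝ) + 1) + n * Real.log A) / Real.log 2 * Real.log (1 / ε) := by
      rw [div_mul_eq_mul_div, le_div_iff₀ hl2]
      gcongr
    nlinarith
  · intro i
    have : ∀ x, (rep (eqv.symm i) x + ε / 2 - (rep (eqv.symm i) x - ε / 2)) ^ 2 = ε ^ 2 :=
      fun x => by ring
    simp only [l2, this]
    simp [Real.sqrt_sq hε.le]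
  · intro G hG
    refine ⟨eqv (code G), fun x hx => ?_⟩
    have hex : ∃ G' : MixM d q k, G'.memΘ Θ ∧ code G' = code G := ⟨G, hG, rfl⟩
    have hr : rep (code G) = MixM.moe h hex.choose := dif_pos hex
    have := abs_le.1 (hcode G hex.choose hG hex.choose_spec.1 hex.choose_spec.2.symm x hx)
    simp only [Equiv.symm_apply_apply, hr]
    constructor <;> linarith [this.1, this.2]
end
end

section
/- (Covering number bound.) Suppose the expert function h is uniformly bounded by M and L₁-Lipschitz in its parameter η uniformly in x. Then there exists a constant C > 0 (depending on Θ, 𝒳, d, q, k, M, L₁) such that for every 0 < τ ≤ 1 there exist mixing measures G_1,…,G_N ∈ 𝒢_k(Θ) with N ≤ C·τ^{−(d+1+q)k} such that for every G ∈ 𝒢_k(Θ) there is some i ≤ N with ‖f_G − f_{G_i}‖_{L²(μ)} ≤ C·τ. -/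
open MeasureTheory Finset ProbabilityTheory
open scoped BigOperators NNReal ENNReal

noncomputable section

theorem aux_net {E ι : Type*} [Fintype ι] (Θ : Set E) (κ : E → ι → ℝ) (R : ℝ) (hR0 : 0 ≤ R)
    (hR : ∀ p ∈ Θ, ∀ i, |κ p i| ≤ R) (τ : ℝ) (h0 : 0 < τ) (h1 : τ ≤ 1) :
    ∃ S : Finset E, (∀ s ∈ S, s ∈ Θ) ∧ (S.card : ℝ) ≤ ((2 * R + 2) / τ) ^ Fintype.card ι ∧
      ∀ p ∈ Θ, ∃ s ∈ S, ∀ i, |κ p i - κ s i| ≤ τ := by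
  classical
  let g : E → ι → ℤ := fun p i => ⌊κ p i / τ⌋
  let P : Finset (ι → ℤ) := Fintype.piFinset fun _ => Finset.Icc ⌊-R / τ⌋ ⌊R / τ⌋
  let T := P.filter fun t => ∃ p ∈ Θ, g p = t
  have hT : ∀ t : T, ∃ p ∈ Θ, g p = t.1 := fun t => (Finset.mem_filter.1 t.2).2
  choose r hr hrg using hT
  refine ⟨Finset.univ.image r, ?_, ?_, ?_⟩
  · intro s hs
    obtain ⟨t, -, rfl⟩ := Finset.mem_image.1 hs
    exact hr t
  · have c1 : (Finset.univ.image r).card ≤ P.card := by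
      refine Finset.card_image_le.trans ?_
      rw [Finset.card_univ, Fintype.card_coe]
      exact Finset.card_le_card (Finset.filter_subset _ _)
    have c2 : P.card = (⌊R / τ⌋ + 1 - ⌊-R / τ⌋).toNat ^ Fintype.card ι := by
      simp [P, Fintype.card_piFinset]
    have hle : ⌊-R / τ⌋ ≤ ⌊R / τ⌋ := by
      apply Int.floor_le_floor
      gcongr
      linarith
    have c3 : (((⌊R / τ⌋ + 1 - ⌊-R / τ⌋).toNat : ℕ) : ℝ) ≤ (2 * R + 2) / τ := by
      have : (((⌊R / τ⌋ + 1 - ⌊-R / τ⌋).toNat : ℕ) : ℝ)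
          = ((⌊R / τ⌋ + 1 - ⌊-R / τ⌋ : ℤ) : ℝ) := by
        have h := Int.toNat_of_nonneg (show 0 ≤ ⌊R / τ⌋ + 1 - ⌊-R / τ⌋ by omega)
        exact_mod_cast congrArg (fun z : ℤ => (z : ℝ)) h
      rw [this]
      push_cast
      have a1 := Int.floor_le (R / τ)
      have a2 := Int.lt_floor_add_one (-R / τ)
      have a3 : 1 ≤ 1 / τ := by rw [le_div_iff₀ h0]; linarith
      have a4 : (2 * R + 2) / τ = R / τ - (-R / τ) + 2 * (1 / τ) := by ring
      linarith
    calc ((Finset.univ.image r).card : ℝ) ≤ (P.card : ℝ) := by exact_mod_cast c1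
      _ = (((⌊R / τ⌋ + 1 - ⌊-R / τ⌋).toNat : ℕ) : ℝ) ^ Fintype.card ι := by
        rw [c2]; push_cast; rfl
      _ ≤ _ := by gcongr
  · intro p hp
    have hgT : g p ∈ T := by
      refine Finset.mem_filter.2 ⟨?_, p, hp, rfl⟩
      refine Fintype.mem_piFinset.2 fun i => Finset.mem_Icc.2 ?_
      have := abs_le.1 (hR p hp i)
      constructor
      · apply Int.floor_le_floor
        gcongr
        exact this.1
      · apply Int.floor_le_floor
        gcongr
        exact this.2
    refine ⟨r ⟨g p, hgT⟩, Finset.mem_image_of_mem _ (Finset.mem_univ _), fun i => ?_⟩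
    have e := congrFun (hrg ⟨g p, hgT⟩) i
    have e2 := Int.abs_sub_lt_one_of_floor_eq_floor e.symm
    rw [← sub_div, abs_div, abs_of_pos h0, div_lt_one h0] at e2
    exact e2.le

theorem aux_norm {n : ℕ} (v : Vec n) (τ : ℝ) (h0 : 0 ≤ τ) (hv : ∀ i, |v i| ≤ τ) :
    ‖v‖ ≤ n * τ := by
  have h1 : ‖v‖ ≤ ∑ i, |v i| := by
    rw [EuclideanSpace.norm_eq]
    apply Real.sqrt_le_iff.2
    refine ⟨Finset.sum_nonneg fun i _ => abs_nonneg _, ?_⟩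
    simp only [Real.norm_eq_abs]
    exact Finset.sum_sq_le_sq_sum_of_nonneg fun i _ => abs_nonneg _
  refine h1.trans ((Finset.sum_le_sum fun i _ => hv i).trans ?_)
  simp

theorem aux_exp (t δ D : ℝ) (ht : |t| ≤ δ) (hD : δ ≤ D) :
    |Real.exp t - 1| ≤ δ * Real.exp D := by
  have e1 : 1 ≤ Real.exp D := Real.one_le_exp ((abs_nonneg t).trans (ht.trans hD))
  have e2 := Real.add_one_le_exp t
  have e3 := Real.add_one_le_exp (-t)
  have e4 : Real.exp t * Real.exp (-t) = 1 := by rw [← Real.exp_add]; simp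
  have e5 : Real.exp t ≤ Real.exp D := Real.exp_le_exp.2 ((le_abs_self t).trans (ht.trans hD))
  have hp := Real.exp_pos t
  have hd : 0 ≤ δ := (abs_nonneg t).trans ht
  obtain ⟨l, u⟩ := abs_le.1 ht
  rw [abs_le]
  constructor
  · nlinarith
  · have : Real.exp t - 1 ≤ t * Real.exp t := by nlinarith
    nlinarith

theorem aux_quot {m : ℕ} (hm : 1 ≤ m) (s s' a a' : Fin m → ℝ) (M ε r : ℝ) (hr : 0 ≤ r)
    (hs : ∀ i, |Real.exp (s' i - s i) - 1| ≤ r) (ha' : ∀ i, |a' i| ≤ M)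
    (haa : ∀ i, |a i - a' i| ≤ ε) :
    |(∑ i, Real.exp (s i) * a i) / (∑ i, Real.exp (s i)) -
      (∑ i, Real.exp (s' i) * a' i) / (∑ i, Real.exp (s' i))| ≤ ε + 2 * M * r := by
  haveI : Nonempty (Fin m) := ⟨⟨0, hm⟩⟩
  have hM : 0 ≤ M := (abs_nonneg _).trans (ha' ⟨0, hm⟩)
  set D := ∑ i, Real.exp (s i) with hD
  set D' := ∑ i, Real.exp (s' i) with hD'
  set N := ∑ i, Real.exp (s i) * a i with hN
  set N' := ∑ i, Real.exp (s' i) * a' i with hN'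
  have pD : 0 < D := Finset.sum_pos (fun i _ => Real.exp_pos _) Finset.univ_nonempty
  have pD' : 0 < D' := Finset.sum_pos (fun i _ => Real.exp_pos _) Finset.univ_nonempty
  have he : ∀ i, |Real.exp (s i) - Real.exp (s' i)| ≤ Real.exp (s i) * r := by
    intro i
    have : Real.exp (s i) - Real.exp (s' i) = -(Real.exp (s i) * (Real.exp (s' i - s i) - 1)) := by
      rw [Real.exp_sub]; field_simp; ring
    rw [this, abs_neg, abs_mul, abs_of_pos (Real.exp_pos _)]
    exact mul_le_mul_of_nonneg_left (hs i) (Real.exp_pos _).le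
  have h1 : |D' - D| ≤ D * r := by
    rw [abs_sub_comm, hD, hD', ← Finset.sum_sub_distrib, Finset.sum_mul]
    exact (Finset.abs_sum_le_sum_abs _ _).trans (Finset.sum_le_sum fun i _ => he i)
  have h2 : |N'| ≤ M * D' := by
    rw [hN', hD', Finset.mul_sum]
    refine (Finset.abs_sum_le_sum_abs _ _).trans (Finset.sum_le_sum fun i _ => ?_)
    rw [abs_mul, abs_of_pos (Real.exp_pos _), mul_comm]
    exact mul_le_mul_of_nonneg_right (ha' i) (Real.exp_pos _).le
  have h3 : |N - N'| ≤ D * (ε + M * r) := by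
    rw [hN, hN', hD, ← Finset.sum_sub_distrib, Finset.sum_mul]
    refine (Finset.abs_sum_le_sum_abs _ _).trans (Finset.sum_le_sum fun i _ => ?_)
    have : Real.exp (s i) * a i - Real.exp (s' i) * a' i =
      Real.exp (s i) * (a i - a' i) + (Real.exp (s i) - Real.exp (s' i)) * a' i := by ring
    rw [this]
    refine (abs_add_le _ _).trans ?_
    rw [abs_mul, abs_mul, abs_of_pos (Real.exp_pos _)]
    have b1 := mul_le_mul_of_nonneg_left (haa i) (Real.exp_pos (s i)).le
    have b2 := mul_le_mul (he i) (ha' i) (abs_nonneg _) (mul_nonneg (Real.exp_pos (s i)).le hr)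
    linarith
  have key : N / D - N' / D' = (N - N') / D + N' / D' * ((D' - D) / D) := by
    field_simp
    ring
  rw [key]
  refine (abs_add_le _ _).trans ?_
  rw [abs_mul, abs_div, abs_div, abs_div, abs_of_pos pD, abs_of_pos pD']
  have g1 : |N - N'| / D ≤ ε + M * r := by rw [div_le_iff₀ pD]; linarith
  have g2 : |N'| / D' ≤ M := by rw [div_le_iff₀ pD']; exact h2
  have g3 : |D' - D| / D ≤ r := by rw [div_le_iff₀ pD]; linarith
  have g4 := mul_le_mul g2 g3 (by positivity) hM
  linarith

/-- Covering number bound for the class `{f_G : G ∈ 𝒢_k(Θ)}` under the `L²(μ)` norm. -/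
theorem covering_number_bound
    {d q k : ℕ}
    (Θ : Set (ℝ × Vec d × Vec q)) (hΘcpt : IsCompact Θ)
    (μ : Measure (Vec d)) [IsProbabilityMeasure μ]
    (B : ℝ) (hXbdd : ∀ᵐ x ∂μ, ‖x‖ ≤ B)
    (h : Vec d → Vec q → ℝ)
    (M L₁ : ℝ) (hM : ∀ x η', |h x η'| ≤ M)
    (hLip : ∀ x η₁ η₂, |h x η₁ - h x η₂| ≤ L₁ * ‖η₁ - η₂‖) :
    ∃ C > 0, ∀ τ : ℝ, 0 < τ → τ ≤ 1 →
      ∃ (N : ℕ) (Gi : Fin N → MixM d q k),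
        (N : ℝ) ≤ C * τ ^ (-(((d + 1 + q) * k : ℕ) : ℝ)) ∧
        (∀ i, (Gi i).memΘ Θ) ∧
        ∀ G : MixM d q k, G.memΘ Θ →
          ∃ i, l2 μ (MixM.moe h G) (MixM.moe h (Gi i)) ≤ C * τ := by
  classical
  obtain ⟨R₀, hR₀⟩ := hΘcpt.isBounded.exists_norm_le
  set R := |R₀| with hRdef
  let κ : ℝ × Vec d × Vec q → (Unit ⊕ Fin d ⊕ Fin q) → ℝ := fun p =>
    Sum.elim (fun _ => p.1) (Sum.elim (fun i => p.2.1 i) (fun i => p.2.2 i))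
  have hκ : ∀ p ∈ Θ, ∀ i, |κ p i| ≤ R := by
    intro p hp i
    have hn : ‖p‖ ≤ R := (hR₀ p hp).trans (le_abs_self _)
    have n1 : ‖p.1‖ ≤ ‖p‖ := norm_fst_le p
    have n2 : ‖p.2‖ ≤ ‖p‖ := norm_snd_le p
    have n3 : ‖p.2.1‖ ≤ ‖p.2‖ := norm_fst_le p.2
    have n4 : ‖p.2.2‖ ≤ ‖p.2‖ := norm_snd_le p.2
    rcases i with i | i | i
    · exact n1.trans hn
    · exact (PiLp.norm_apply_le p.2.1 i).trans (n3.trans (n2.trans hn))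
    · exact (PiLp.norm_apply_le p.2.2 i).trans (n4.trans (n2.trans hn))
  have hM0 : 0 ≤ M := (abs_nonneg _).trans (hM 0 0)
  set Q := (d : ℝ) * |B| + 1 with hQ
  have hQ0 : 0 ≤ Q := by positivity
  set A := |L₁| * q + 2 * M * (Q * Real.exp Q) with hA
  have hA0 : 0 ≤ A := by positivity
  set A2 := (k : ℝ) * (2 * R + 2) ^ ((d + 1 + q) * k) with hA2
  have hA20 : 0 ≤ A2 := by positivity
  refine ⟨A + A2 + 1, by positivity, fun τ h0 h1 => ?_⟩
  obtain ⟨S, hSΘ, hScard, hSnet⟩ := aux_net Θ κ R (abs_nonneg _) hκ τ h0 h1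
  have hι : Fintype.card (Unit ⊕ Fin d ⊕ Fin q) = d + 1 + q := by
    simp only [Fintype.card_sum, Fintype.card_unit, Fintype.card_fin]; omega
  rw [hι] at hScard
  let I := Fin k × (Fin k → S)
  let mk : I → MixM d q k := fun z =>
    { m := z.1 + 1
      one_le_m := by omega
      m_le_k := z.1.2
      β0 := fun i => (z.2 (Fin.castLE z.1.2 i)).1.1
      β1 := fun i => (z.2 (Fin.castLE z.1.2 i)).1.2.1
      η := fun i => (z.2 (Fin.castLE z.1.2 i)).1.2.2 }
  refine ⟨Fintype.card I, fun i => mk ((Fintype.equivFin I).symm i), ?_, ?_, ?_⟩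
  · have hc : (Fintype.card I : ℝ) = k * (S.card : ℝ) ^ k := by
      simp [I]
    rw [hc, Real.rpow_neg h0.le, Real.rpow_natCast]
    have : (k : ℝ) * (S.card : ℝ) ^ k ≤ A2 * (τ ^ ((d + 1 + q) * k))⁻¹ := by
      calc (k : ℝ) * (S.card : ℝ) ^ k ≤ k * (((2 * R + 2) / τ) ^ (d + 1 + q)) ^ k := by gcongr
        _ = A2 * (τ ^ ((d + 1 + q) * k))⁻¹ := by
          rw [← pow_mul, div_pow, hA2]; ring
    refine this.trans ?_
    gcongr
    linarith
  · intro i j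
    exact hSΘ _ (((Fintype.equivFin I).symm i).2 _).2
  · rintro ⟨m, hm1, hmk, β0, β1, η⟩ hG
    choose s hsS hs using fun i => hSnet _ (hG i)
    obtain ⟨m, rfl⟩ : ∃ n, m = n + 1 := ⟨m - 1, by omega⟩
    let z : I := (⟨m, hmk⟩, fun j => if hj : j.1 < m + 1 then ⟨s ⟨j.1, hj⟩, hsS _⟩
      else ⟨s ⟨0, hm1⟩, hsS _⟩)
    have hz : mk z = ⟨m + 1, hm1, hmk, fun i => (s i).1, fun i => (s i).2.1, fun i => (s i).2.2⟩ := by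
      simp only [mk, z]
      congr 1 <;> funext i <;> simp [Nat.le_of_lt_succ i.2]
    refine ⟨Fintype.equivFin I z, ?_⟩
    simp only [Equiv.symm_apply_apply]
    rw [hz]
    have hb0 : ∀ i, |β0 i - (s i).1| ≤ τ := fun i => hs i (Sum.inl ())
    have hb1 : ∀ i, ‖β1 i - (s i).2.1‖ ≤ d * τ := fun i =>
      aux_norm _ _ h0.le fun u => hs i (Sum.inr (Sum.inl u))
    have hb2 : ∀ i, ‖η i - (s i).2.2‖ ≤ q * τ := fun i =>
      aux_norm _ _ h0.le fun u => hs i (Sum.inr (Sum.inr u))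
    have hpt : ∀ x : Vec d, ‖x‖ ≤ B →
        |MixM.moe h ⟨m + 1, hm1, hmk, β0, β1, η⟩ x - MixM.moe h (k := k)
          ⟨m + 1, hm1, hmk, fun i => (s i).1, fun i => (s i).2.1, fun i => (s i).2.2⟩ x|
          ≤ A * τ := by
      intro x hx
      have hmain := aux_quot hm1 (fun i => (∑ u, β1 i u * x u) + β0 i)
        (fun i => (∑ u, (s i).2.1 u * x u) + (s i).1) (fun i => h x (η i))
        (fun i => h x (s i).2.2) M (|L₁| * (q * τ)) (Q * τ * Real.exp Q) (by positivity)
        ?_ (fun i => hM _ _) ?_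
      · refine hmain.trans (le_of_eq ?_)
        rw [hA]; ring
      · intro i
        apply aux_exp
        · have e : (∑ u, (s i).2.1 u * x u) + (s i).1 - ((∑ u, β1 i u * x u) + β0 i)
              = -(inner ℝ x (β1 i - (s i).2.1) + (β0 i - (s i).1)) := by
            simp only [PiLp.inner_apply, PiLp.sub_apply, RCLike.inner_apply, conj_trivial,
              sub_mul, Finset.sum_sub_distrib]
            ring
          simp only [e, abs_neg]
          refine (abs_add_le _ _).trans ?_
          have i1 := abs_real_inner_le_norm x (β1 i - (s i).2.1)
          have i2 : ‖x‖ * ‖β1 i - (s i).2.1‖ ≤ |B| * (d * τ) :=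
            mul_le_mul (hx.trans (le_abs_self B)) (hb1 i) (norm_nonneg _) (abs_nonneg _)
          have i3 := hb0 i
          rw [hQ]
          linarith
        · exact mul_le_of_le_one_right hQ0 h1
      · intro i
        refine (hLip _ _ _).trans ?_
        exact mul_le_mul (le_abs_self _) (hb2 i) (norm_nonneg _) (abs_nonneg _)
    unfold l2
    refine le_trans (Real.sqrt_le_iff.2 ⟨mul_nonneg hA0 h0.le, ?_⟩)
      (show A * τ ≤ (A + A2 + 1) * τ from mul_le_mul_of_nonneg_right (by linarith) h0.le)
    have := norm_integral_le_of_norm_le_const (μ := μ) (C := (A * τ) ^ 2)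
      (f := fun x => (MixM.moe h ⟨m + 1, hm1, hmk, β0, β1, η⟩ x - MixM.moe h (k := k)
          ⟨m + 1, hm1, hmk, fun i => (s i).1, fun i => (s i).2.1, fun i => (s i).2.2⟩ x) ^ 2) ?_
    · simp only [probReal_univ, mul_one] at this
      exact (le_abs_self _).trans this
    · filter_upwards [hXbdd] with x hx
      rw [norm_pow, Real.norm_eq_abs]
      exact pow_le_pow_left₀ (abs_nonneg _) (hpt x hx) 2
end
end
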